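/- For every r > 0, the boundary of the Euclidean convex hull of the ball B(O,r) is the union of the set of points of S(O,r) corresponding to parameters φ with |φ|r ≤ π and the two Euclidean discs {(z;t) : t = (2/π)r², |z| ≤ (2/π)r} and {(z;t) : t = −(2/π)r², |z| ≤ (2/π)r}. -/

import Mathlib

noncomputable section

open MeasureTheory

/-- Points of the Heisenberg group `ℍ`, identified with `ℝ³ ≅ ℂ × ℝ`:
`(x, y, t)` corresponds to `(z ; t)` with `z = x + iy`. -/
abbrev H : Type := ℝ × ℝ × ℝ

/-- The Heisenberg group law
`(x,y,t)·(x',y',t') = (x+x', y+y', t+t'+2(x'y − xy'))`. -/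
def Hmul (p q : H) : H :=
  (p.1 + q.1, p.2.1 + q.2.1, p.2.2 + q.2.2 + 2 * (q.1 * p.2.1 - p.1 * q.2.1))

/-- The Heisenberg group inverse. -/
def Hinv (p : H) : H := (-p.1, -p.2.1, -p.2.2)

/-- The identity `O = (0,0,0)`. -/
def HO : H := (0, 0, 0)

/-- The control (Carnot–Carathéodory) distance: the infimum of the lengths
`∫₀¹ √(a(s)² + b(s)²) ds` of horizontal Lipschitz curves `γ` joining `P` to `Q`,
i.e. curves satisfying a.e. `γ' = a·X(γ) + b·Y(γ)` where `X = ∂ₓ + 2y∂_t` and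
`Y = ∂_y − 2x∂_t`. -/
def dH (P Q : H) : ℝ :=
  sInf { L : ℝ | ∃ (γ : ℝ → H) (a b : ℝ → ℝ) (K : NNReal),
    LipschitzWith K γ ∧ γ 0 = P ∧ γ 1 = Q ∧
    (∀ᵐ s ∂volume, s ∈ Set.Icc (0:ℝ) 1 →
      HasDerivAt γ (a s, b s, 2 * (γ s).2.1 * a s - 2 * (γ s).1 * b s) s) ∧
    IntervalIntegrable (fun s => Real.sqrt (a s ^ 2 + b s ^ 2)) volume 0 1 ∧
    L = ∫ s in (0:ℝ)..1, Real.sqrt (a s ^ 2 + b s ^ 2) }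

/-- `γ : ℝ → ℍ` is a `(1+ε)`-quasigeodesic. -/
def IsQuasiGeodesic (ε : ℝ) (γ : ℝ → H) : Prop :=
  ∀ s s' : ℝ, (1 + ε)⁻¹ * |s - s'| ≤ dH (γ s) (γ s') ∧
    dH (γ s) (γ s') ≤ (1 + ε) * |s - s'|

/-- `f : ℍ → ℍ` is `(1+ε)`-biLipschitz for the control distance. -/
def IsBiLip (ε : ℝ) (f : H → H) : Prop :=
  ∀ P Q : H, (1 + ε)⁻¹ * dH P Q ≤ dH (f P) (f Q) ∧ dH (f P) (f Q) ≤ (1 + ε) * dH P Q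

/-- `(a,b)` is the horizontal speed of `γ`: a.e. `γ'(s) = a(s)X(γ(s)) + b(s)Y(γ(s))`. -/
def HasHorizSpeed (γ : ℝ → H) (a b : ℝ → ℝ) : Prop :=
  ∀ᵐ s ∂volume, HasDerivAt γ (a s, b s, 2 * (γ s).2.1 * a s - 2 * (γ s).1 * b s) s

/-- The set of lengths in the definition of `dH`. -/
def lenSet (P Q : H) : Set ℝ := { L : ℝ | ∃ (γ : ℝ → H) (a b : ℝ → ℝ) (K : NNReal),
    LipschitzWith K γ ∧ γ 0 = P ∧ γ 1 = Q ∧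
    (∀ᵐ s ∂volume, s ∈ Set.Icc (0:ℝ) 1 →
      HasDerivAt γ (a s, b s, 2 * (γ s).2.1 * a s - 2 * (γ s).1 * b s) s) ∧
    IntervalIntegrable (fun s => Real.sqrt (a s ^ 2 + b s ^ 2)) volume 0 1 ∧
    L = ∫ s in (0:ℝ)..1, Real.sqrt (a s ^ 2 + b s ^ 2) }

lemma dH_eq (P Q : H) : dH P Q = sInf (lenSet P Q) := rfl

lemma lenSet_nonneg {P Q : H} {L : ℝ} (h : L ∈ lenSet P Q) : 0 ≤ L := by
  obtain ⟨γ, a, b, K, -, -, -, -, -, rfl⟩ := h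
  exact intervalIntegral.integral_nonneg (by norm_num) (fun _ _ => Real.sqrt_nonneg _)

lemma dH_le {P Q : H} {L : ℝ} (h : L ∈ lenSet P Q) : dH P Q ≤ L :=
  csInf_le ⟨0, fun _ h => lenSet_nonneg h⟩ h

lemma curve_mem (γ : ℝ → H) (a b : ℝ → ℝ) (ha : Continuous a) (hb : Continuous b)
    (hγ : ∀ s, HasDerivAt γ (a s, b s, 2 * (γ s).2.1 * a s - 2 * (γ s).1 * b s) s) :
    (∫ s in (0:ℝ)..1, Real.sqrt (a s ^ 2 + b s ^ 2)) ∈ lenSet (γ 0) (γ 1) := by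
  have hc : Continuous γ := continuous_iff_continuousAt.2 fun s => (hγ s).continuousAt
  have hc' : Continuous (fun s => (a s, b s, 2 * (γ s).2.1 * a s - 2 * (γ s).1 * b s)) := by
    fun_prop
  obtain ⟨C, hC⟩ := (isCompact_Icc (a := (0:ℝ)) (b := 1)).exists_bound_of_continuousOn
    hc'.continuousOn
  have hL : LipschitzOnWith (Real.toNNReal C) γ (Set.Icc 0 1) := by
    refine Convex.lipschitzOnWith_of_nnnorm_hasDerivWithin_le (convex_Icc 0 1)
      (fun s _ => (hγ s).hasDerivWithinAt) (fun s hs => ?_)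
    rw [← NNReal.coe_le_coe]
    exact (hC s hs).trans (Real.le_coe_toNNReal C)
  have h01 : (0:ℝ) ≤ 1 := by norm_num
  let δ : ℝ → H := fun s => γ (Set.projIcc 0 1 h01 s)
  have hδ : ∀ s ∈ Set.Icc (0:ℝ) 1, δ s = γ s := fun s hs => by
    simp only [δ, Set.projIcc_of_mem h01 hs]
  refine ⟨δ, a, b, Real.toNNReal C, ?_, ?_, ?_, ?_, ?_, rfl⟩
  · have h1 := hL.to_restrict.comp (LipschitzWith.projIcc h01)
    rw [mul_one] at h1
    exact h1
  · exact hδ 0 (by simp)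
  · exact hδ 1 (by simp)
  · have h0 : ∀ᵐ s : ℝ, s ≠ 0 := by simp [ae_iff]
    have h1 : ∀ᵐ s : ℝ, s ≠ 1 := by simp [ae_iff]
    filter_upwards [h0, h1] with s h0 h1 hs
    rw [hδ s hs]
    refine (hγ s).congr_of_eventuallyEq ?_
    filter_upwards [Icc_mem_nhds (lt_of_le_of_ne hs.1 (Ne.symm h0)) (lt_of_le_of_ne hs.2 h1)]
      with u hu using hδ u hu
  · exact (by fun_prop : Continuous fun s => Real.sqrt (a s ^ 2 + b s ^ 2)).intervalIntegrable _ _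

lemma lenSet_nonempty (p : H) : (lenSet HO p).Nonempty := by
  obtain ⟨x, y, t⟩ := p
  obtain ⟨A, hA⟩ : ∃ A, A = 5 * x - 30 := ⟨_, rfl⟩
  obtain ⟨B, hB⟩ : ∃ B, B = t / 2 + y * A / 3 := ⟨_, rfl⟩
  have h := curve_mem (fun s => (x * s + A * (s - s ^ 2), y * s + B * (s ^ 2 - s ^ 3),
    2 * (y * A * (- s ^ 3 / 3) + x * B * (- s ^ 3 / 3 + s ^ 4 / 2)
      + A * B * (- s ^ 3 / 3 + s ^ 4 / 2 - s ^ 5 / 5))))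
    (fun s => x + A * (1 - 2 * s)) (fun s => y + B * (2 * s - 3 * s ^ 2))
    (by fun_prop) (by fun_prop) (fun s => by
      have p1 := hasDerivAt_id' s
      have p2 : HasDerivAt (fun s : ℝ => s ^ 2) (2 * s) s := by simpa using hasDerivAt_pow 2 s
      have p3 : HasDerivAt (fun s : ℝ => s ^ 3) (3 * s ^ 2) s := by simpa using hasDerivAt_pow 3 s
      have p4 : HasDerivAt (fun s : ℝ => s ^ 4) (4 * s ^ 3) s := by simpa using hasDerivAt_pow 4 s
      have p5 : HasDerivAt (fun s : ℝ => s ^ 5) (5 * s ^ 4) s := by simpa using hasDerivAt_pow 5 s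
      refine HasDerivAt.prodMk ?_ (HasDerivAt.prodMk ?_ ?_)
      · exact ((p1.const_mul x).add ((p1.sub p2).const_mul A)).congr_deriv (by ring)
      · exact ((p1.const_mul y).add ((p2.sub p3).const_mul B)).congr_deriv (by ring)
      · refine HasDerivAt.congr_deriv (((((p3.neg.div_const 3).const_mul (y * A)).add
          (((p3.neg.div_const 3).add (p4.div_const 2)).const_mul (x * B))).add
          ((((p3.neg.div_const 3).add (p4.div_const 2)).sub (p5.div_const 5)).const_mul
            (A * B))).const_mul 2) ?_
        ring)
  refine ⟨∫ s in (0:ℝ)..1, Real.sqrt ((x + A * (1 - 2 * s)) ^ 2 + (y + B * (2 * s - 3 * s ^ 2)) ^ 2), ?_⟩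
  · convert h using 1
    congr 1
    · simp [HO]
    · simp only [Prod.mk.injEq]
      refine ⟨by ring, by ring, ?_⟩
      rw [hB, hA]; ring

lemma exists_lt_of_dH {p : H} {r : ℝ} (h : dH HO p < r) : ∃ L ∈ lenSet HO p, L < r :=
  exists_lt_of_csInf_lt (lenSet_nonempty p) h

/-- Arc endpoints, `θ = φ r / 2`. -/
def arc (r θ : ℝ) (p : H) : Prop :=
  Real.sqrt (p.1 ^ 2 + p.2.1 ^ 2) = r * Real.sinc θ ∧
    p.2.2 = r ^ 2 * ((θ - Real.sin θ * Real.cos θ) / θ ^ 2)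

lemma arc_dH {r θ : ℝ} (hr : 0 < r) (hθ : |θ| ≤ Real.pi / 2) {p : H} (h : arc r θ p) :
    dH HO p ≤ r := by
  obtain ⟨x, y, t⟩ := p
  obtain ⟨h1, h2⟩ := h
  simp only at h1 h2
  by_cases h0 : θ = 0
  · subst h0
    simp at h1 h2
    subst h2
    have h := curve_mem (fun s => (x * s, y * s, 0)) (fun _ => x) (fun _ => y)
      (by fun_prop) (by fun_prop) (fun s => by
        have p1 := hasDerivAt_id' s
        refine HasDerivAt.prodMk ?_ (HasDerivAt.prodMk ?_ ?_)
        · exact (p1.const_mul x).congr_deriv (by ring)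
        · exact (p1.const_mul y).congr_deriv (by ring)
        · exact (hasDerivAt_const s (0:ℝ)).congr_deriv (by ring))
    have := dH_le h
    simpa [h1, HO] using this
  · have hpi := Real.pi_pos
    have hs : Real.sin θ ≠ 0 := by
      intro h
      rw [abs_le] at hθ
      exact h0 ((Real.sin_eq_zero_iff_of_lt_of_lt (by linarith) (by linarith)).1 h)
    rw [Real.sinc_of_ne_zero h0] at h1
    have hR : x ^ 2 + y ^ 2 = (r * (Real.sin θ / θ)) ^ 2 := by
      rw [← h1, Real.sq_sqrt (by positivity)]
    have h := curve_mem
      (fun s => ((x * Real.cos (θ * (1 - s)) - y * Real.sin (θ * (1 - s))) * Real.sin (θ * s) / Real.sin θ,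
        (x * Real.sin (θ * (1 - s)) + y * Real.cos (θ * (1 - s))) * Real.sin (θ * s) / Real.sin θ,
        (x ^ 2 + y ^ 2) / Real.sin θ ^ 2 * (θ * s - Real.sin (θ * s) * Real.cos (θ * s))))
      (fun s => θ / Real.sin θ * ((x * Real.sin (θ * (1 - s)) + y * Real.cos (θ * (1 - s))) * Real.sin (θ * s)
        + (x * Real.cos (θ * (1 - s)) - y * Real.sin (θ * (1 - s))) * Real.cos (θ * s)))
      (fun s => θ / Real.sin θ * ((-x * Real.cos (θ * (1 - s)) + y * Real.sin (θ * (1 - s))) * Real.sin (θ * s)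
        + (x * Real.sin (θ * (1 - s)) + y * Real.cos (θ * (1 - s))) * Real.cos (θ * s)))
      (by fun_prop) (by fun_prop) (fun s => by
        have q1 : HasDerivAt (fun s => θ * s) θ s := by simpa using (hasDerivAt_id' s).const_mul θ
        have q2 : HasDerivAt (fun s => θ * (1 - s)) (-θ) s := by
          simpa using ((hasDerivAt_id' s).const_sub 1).const_mul θ
        have e1 := Real.sin_sq_add_cos_sq (θ * s)
        have e2 := Real.sin_sq_add_cos_sq (θ * (1 - s))
        refine HasDerivAt.prodMk ?_ (HasDerivAt.prodMk ?_ ?_)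
        · refine HasDerivAt.congr_deriv ((((q2.cos.const_mul x).sub (q2.sin.const_mul y)).mul q1.sin).div_const _) ?_
          simp only [Pi.sub_apply, Pi.add_apply]
          ring
        · refine HasDerivAt.congr_deriv ((((q2.sin.const_mul x).add (q2.cos.const_mul y)).mul q1.sin).div_const _) ?_
          simp only [Pi.sub_apply, Pi.add_apply]
          ring
        · refine HasDerivAt.congr_deriv ((q1.sub (q1.sin.mul q1.cos)).const_mul ((x ^ 2 + y ^ 2) / Real.sin θ ^ 2)) ?_
          generalize Real.sin (θ * s) = S at *
          generalize Real.cos (θ * s) = C at *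
          generalize Real.sin (θ * (1 - s)) = S1 at *
          generalize Real.cos (θ * (1 - s)) = C1 at *
          field_simp
          have e3 : S1 ^ 2 = 1 - C1 ^ 2 := by linarith
          have e4 : C ^ 2 = 1 - S ^ 2 := by linarith
          ring_nf
          simp only [e3, e4]
          ring)
    have := dH_le h
    have hv : ∀ s, Real.sqrt ((θ / Real.sin θ * ((x * Real.sin (θ * (1 - s)) + y * Real.cos (θ * (1 - s))) * Real.sin (θ * s)
        + (x * Real.cos (θ * (1 - s)) - y * Real.sin (θ * (1 - s))) * Real.cos (θ * s))) ^ 2 +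
        (θ / Real.sin θ * ((-x * Real.cos (θ * (1 - s)) + y * Real.sin (θ * (1 - s))) * Real.sin (θ * s)
        + (x * Real.sin (θ * (1 - s)) + y * Real.cos (θ * (1 - s))) * Real.cos (θ * s))) ^ 2) = r := by
      intro s
      rw [← Real.sqrt_sq hr.le]
      congr 1
      have e1 := Real.sin_sq_add_cos_sq (θ * s)
      have e2 := Real.sin_sq_add_cos_sq (θ * (1 - s))
      have : r ^ 2 = (θ / Real.sin θ) ^ 2 * (x ^ 2 + y ^ 2) := by rw [hR]; field_simp
      rw [this]
      linear_combination (θ / Real.sin θ) ^ 2 * (x ^ 2 + y ^ 2) * ((Real.sin (θ * (1 - s)) ^ 2 + Real.cos (θ * (1 - s)) ^ 2) * e1 + e2)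
    simp only [hv] at this
    have e0 : HO = ((0:ℝ), (0:ℝ), (0:ℝ)) := rfl
    simp at this
    rw [e0]
    convert this using 2
    simp only [Prod.mk.injEq]
    refine ⟨by field_simp, by field_simp, ?_⟩
    rw [h2, hR]
    field_simp

lemma alg_ineq {k S Co w A B X Y e : ℝ} (hk0 : 0 < k) (hS : 0 < S) (hsc : S ^ 2 + Co ^ 2 = 1)
    (hv2 : w ^ 2 = A ^ 2 + B ^ 2) (hv0 : 0 ≤ w) (he : e ^ 2 = 1) :
    e * (2 * Y * A - 2 * X * B) + ((A * X + X * A + (B * Y + Y * B)) * (Co / S) +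
        (X * X + Y * Y) * (-k / S ^ 2 * w)) - k⁻¹ * w ≤ 0 := by
  have h1 : 1 + (Co / S) ^ 2 = 1 / S ^ 2 := by field_simp; linarith
  have h2 : (2 * (e * (Y * A - X * B) + (X * A + Y * B) * (Co / S))) ^ 2
      ≤ (w * ((X ^ 2 + Y ^ 2) * k / S ^ 2 + k⁻¹)) ^ 2 := by
    have h3 : (e * (Y * A - X * B) + (X * A + Y * B) * (Co / S)) ^ 2 ≤
        (X ^ 2 + Y ^ 2) * w ^ 2 * (1 + (Co / S) ^ 2) := by
      rw [hv2]
      have : (X ^ 2 + Y ^ 2) * (A ^ 2 + B ^ 2) * (1 + (Co / S) ^ 2) -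
        (e * (Y * A - X * B) + (X * A + Y * B) * (Co / S)) ^ 2 =
        (e * (X * A + Y * B) - (Y * A - X * B) * (Co / S)) ^ 2 := by
        linear_combination (-((Y * A - X * B) ^ 2 + (X * A + Y * B) ^ 2)) * he
      nlinarith [sq_nonneg (e * (X * A + Y * B) - (Y * A - X * B) * (Co / S))]
    rw [h1] at h3
    have h4 : (w * ((X ^ 2 + Y ^ 2) * k / S ^ 2 + k⁻¹)) ^ 2 - 4 * ((X ^ 2 + Y ^ 2) * w ^ 2 * (1 / S ^ 2))
      = (w * ((X ^ 2 + Y ^ 2) * k / S ^ 2 - k⁻¹)) ^ 2 := by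
      field_simp
      ring
    nlinarith [sq_nonneg (w * ((X ^ 2 + Y ^ 2) * k / S ^ 2 - k⁻¹))]
  have h5 := abs_le_of_sq_le_sq' h2 (by positivity)
  have h6 := h5.2
  have : e * (2 * Y * A - 2 * X * B) + ((A * X + X * A + (B * Y + Y * B)) * (Co / S) +
      (X * X + Y * Y) * (-k / S ^ 2 * w)) - k⁻¹ * w =
      2 * (e * (Y * A - X * B) + (X * A + Y * B) * (Co / S)) -
        w * ((X ^ 2 + Y ^ 2) * k / S ^ 2 + k⁻¹) := by
    ring
  linarith

lemma calib {p : H} {r L θ e : ℝ} (hL : L ∈ lenSet HO p) (hLr : L < r)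
    (h0 : 0 < θ) (hθ : θ ≤ Real.pi / 2) (he : e ^ 2 = 1) :
    e * p.2.2 + (p.1 ^ 2 + p.2.1 ^ 2) * (Real.cos θ / Real.sin θ) ≤ r ^ 2 / θ := by
  have hL0 := lenSet_nonneg hL
  obtain ⟨γ, a, b, K, hK, hγ0, hγ1, hder, hint, hLeq⟩ := hL
  have hr : 0 < r := hL0.trans_lt hLr
  obtain ⟨k, hk⟩ : ∃ k, k = θ / r := ⟨_, rfl⟩
  have hk0 : 0 < k := hk ▸ div_pos h0 hr
  have hkr : k * r = θ := by rw [hk]; field_simp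
  set v : ℝ → ℝ := fun s => Real.sqrt (a s ^ 2 + b s ^ 2) with hv
  set l : ℝ → ℝ := fun s => (r - L) + ∫ u in (0:ℝ)..s, v u with hl
  have hpi := Real.pi_pos
  have hl0 : l 0 = r - L := by simp [hl]
  have hl1 : l 1 = r := by simp only [hl]; rw [← hLeq]; ring
  have hsub : ∀ s ∈ Set.Icc (0:ℝ) 1, IntervalIntegrable v volume 0 s := fun s hs =>
    hint.mono_set (by rw [Set.uIcc_of_le hs.1, Set.uIcc_of_le zero_le_one]
                      exact Set.Icc_subset_Icc_right hs.2)
  have hdiff : ∀ s ∈ Set.Icc (0:ℝ) 1, ∀ s' ∈ Set.Icc (0:ℝ) 1, l s' - l s = ∫ u in s..s', v u := by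
    intro s hs s' hs'
    rw [← intervalIntegral.integral_interval_sub_left (hsub s' hs') (hsub s hs)]
    simp [hl]
  have hmono : ∀ s ∈ Set.Icc (0:ℝ) 1, ∀ s' ∈ Set.Icc (0:ℝ) 1, s ≤ s' → l s ≤ l s' := by
    intro s hs s' hs' hle
    have := hdiff s hs s' hs'
    have h2 : 0 ≤ ∫ u in s..s', v u :=
      intervalIntegral.integral_nonneg hle (fun _ _ => Real.sqrt_nonneg _)
    linarith
  have hlmem : ∀ s ∈ Set.Icc (0:ℝ) 1, l s ∈ Set.Icc (r - L) r := by
    intro s hs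
    constructor
    · rw [← hl0]; exact hmono 0 (by simp) s hs hs.1
    · rw [← hl1]; exact hmono s hs 1 (by simp) hs.2
  have hvb : ∀ᵐ s, s ∈ Set.Icc (0:ℝ) 1 → ‖v s‖ ≤ 2 * K := by
    filter_upwards [hder] with s hs hmem
    have h1 := (hs hmem).le_of_lipschitz hK
    have ha : ‖a s‖ ≤ K := (norm_fst_le _).trans h1
    have hb : ‖b s‖ ≤ K := ((norm_fst_le _).trans (norm_snd_le _)).trans h1
    rw [Real.norm_eq_abs] at ha hb
    have : v s ≤ 2 * K := by
      apply Real.sqrt_le_iff.2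
      refine ⟨by positivity, ?_⟩
      have h3 := sq_le_sq' (abs_le.1 ha).1 (abs_le.1 ha).2
      have h4 := sq_le_sq' (abs_le.1 hb).1 (abs_le.1 hb).2
      nlinarith
    rw [Real.norm_of_nonneg (Real.sqrt_nonneg _)]
    exact this
  have hlLip : LipschitzOnWith (2 * K) l (Set.uIcc 0 1) := by
    rw [Set.uIcc_of_le zero_le_one]
    refine LipschitzOnWith.of_dist_le_mul fun s' hs' s hs => ?_
    rw [Real.dist_eq, hdiff s hs s' hs', Real.dist_eq]
    have e0 : ((2 * K : NNReal) : ℝ) = 2 * (K : ℝ) := by push_cast; rfl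
    rw [e0]
    refine intervalIntegral.norm_integral_le_of_norm_le_const_ae (f := v) (C := 2 * (K : ℝ)) ?_
    filter_upwards [hvb] with u hu hu'
    refine hu ?_
    have := Set.uIoc_subset_uIcc hu'
    exact Set.uIcc_subset_Icc hs hs' this
  have hspos : ∀ u ∈ Set.Icc (r - L) r, 0 < Real.sin (k * u) := by
    intro u hu
    apply Real.sin_pos_of_pos_of_lt_pi
    · exact mul_pos hk0 (by linarith [hu.1])
    · have := mul_le_mul_of_nonneg_left hu.2 hk0.le
      linarith
  set c : ℝ → ℝ := fun u => Real.cos (k * u) / Real.sin (k * u) with hc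
  have hcder : ∀ u ∈ Set.Icc (r - L) r, HasDerivAt c (-k / Real.sin (k * u) ^ 2) u := by
    intro u hu
    have hp := (hspos u hu).ne'
    have q1 : HasDerivAt (fun s => k * s) k u := by simpa using (hasDerivAt_id' u).const_mul k
    refine (q1.cos.div q1.sin hp).congr_deriv ?_
    have := Real.sin_sq_add_cos_sq (k * u)
    congr 1
    linear_combination (-k) * this
  have hcLip : ∃ C, LipschitzOnWith C c (Set.Icc (r - L) r) := by
    have hcont : ContinuousOn (fun u => -k / Real.sin (k * u) ^ 2) (Set.Icc (r - L) r) :=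
      ContinuousOn.div (by fun_prop) (by fun_prop) (fun u hu => pow_ne_zero _ (hspos u hu).ne')
    obtain ⟨C, hC⟩ := isCompact_Icc.exists_bound_of_continuousOn hcont
    refine ⟨Real.toNNReal C, Convex.lipschitzOnWith_of_nnnorm_hasDerivWithin_le (convex_Icc _ _)
      (fun s hs => (hcder s hs).hasDerivWithinAt) (fun s hs => ?_)⟩
    rw [← NNReal.coe_le_coe]
    exact (hC s hs).trans (Real.le_coe_toNNReal C)
  obtain ⟨C, hC⟩ := hcLip
  have hclLip : LipschitzOnWith (C * (2 * K)) (fun s => c (l s)) (Set.uIcc 0 1) :=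
    hC.comp hlLip (by rw [Set.uIcc_of_le zero_le_one]; exact hlmem)
  have hx : LipschitzWith K (fun s => (γ s).1) := by
    simpa [Function.comp_def] using LipschitzWith.prod_fst.comp hK
  have hy : LipschitzWith K (fun s => (γ s).2.1) := by
    simpa [Function.comp_def] using (LipschitzWith.prod_fst.comp LipschitzWith.prod_snd).comp hK
  have ht : LipschitzWith K (fun s => (γ s).2.2) := by
    simpa [Function.comp_def] using (LipschitzWith.prod_snd.comp LipschitzWith.prod_snd).comp hK
  have ax := (hx.lipschitzOnWith (s := Set.uIcc 0 1)).absolutelyContinuousOnInterval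
  have ay := (hy.lipschitzOnWith (s := Set.uIcc 0 1)).absolutelyContinuousOnInterval
  have at' := (ht.lipschitzOnWith (s := Set.uIcc 0 1)).absolutelyContinuousOnInterval
  have al := hlLip.absolutelyContinuousOnInterval
  have ac := hclLip.absolutelyContinuousOnInterval
  have hG := ((at'.const_mul e).fun_add (((ax.fun_mul ax).fun_add (ay.fun_mul ay)).fun_mul ac)).fun_sub
    (al.const_mul k⁻¹)
  have hFTC := hG.integral_deriv_eq_sub
  have hle : (∫ s in (0:ℝ)..1, deriv (fun s => e * (γ s).2.2 +
      ((γ s).1 * (γ s).1 + (γ s).2.1 * (γ s).2.1) * c (l s) - k⁻¹ * l s) s) ≤ 0 := by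
    rw [intervalIntegral.integral_of_le zero_le_one]
    refine integral_nonpos_of_ae ?_
    rw [Filter.EventuallyLE, ae_restrict_iff' measurableSet_Ioc]
    filter_upwards [hder, hint.ae_hasDerivAt_integral] with s hs hs2 hmem'
    have hmem : s ∈ Set.Icc (0:ℝ) 1 := Set.Ioc_subset_Icc_self hmem'
    have hd := hs hmem
    have hld : HasDerivAt l (v s) s :=
      (hs2 (by rwa [Set.uIcc_of_le zero_le_one]) 0 (by simp)).const_add (r - L)
    have hcd := (hcder _ (hlmem s hmem)).comp s hld
    have dx : HasDerivAt (fun s => (γ s).1) (a s) s := hd.fst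
    have dy : HasDerivAt (fun s => (γ s).2.1) (b s) s := hd.snd.fst
    have dt : HasDerivAt (fun s => (γ s).2.2) _ s := hd.snd.snd
    have hall := ((dt.const_mul e).fun_add (((dx.fun_mul dx).fun_add (dy.fun_mul dy)).fun_mul hcd)).fun_sub
      (hld.const_mul k⁻¹)
    have hall' := hall.deriv
    simp only [Function.comp_def] at hall'
    rw [hall']
    simp only [Pi.zero_apply]
    have hS := hspos _ (hlmem s hmem)
    have hsc := Real.sin_sq_add_cos_sq (k * l s)
    have hv2 : v s ^ 2 = a s ^ 2 + b s ^ 2 := Real.sq_sqrt (by positivity)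
    have hv0 : 0 ≤ v s := Real.sqrt_nonneg _
    have hcs : c (l s) = Real.cos (k * l s) / Real.sin (k * l s) := rfl
    rw [hcs]
    generalize Real.sin (k * l s) = S at *
    generalize Real.cos (k * l s) = Co at *
    generalize v s = w at *
    generalize a s = A at *
    generalize b s = B at *
    generalize (γ s).1 = X at *
    generalize (γ s).2.1 = Y at *
    exact alg_ineq hk0 hS hsc hv2 hv0 he
  rw [hFTC] at hle
  rw [hγ1, hγ0, hl1, hl0] at hle
  simp only [HO, hc, hkr] at hle
  have e1 : r ^ 2 / θ = k⁻¹ * r := by rw [hk]; field_simp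
  rw [e1]
  have : 0 ≤ k⁻¹ * (r - L) := by have := sub_pos.2 hLr; positivity
  nlinarith

/-- The convex body. -/
def KK (r : ℝ) : Set H := { p | ∀ θ : ℝ, 0 < θ → θ ≤ Real.pi / 2 →
  |p.2.2| + (p.1 ^ 2 + p.2.1 ^ 2) * (Real.cos θ / Real.sin θ) ≤ r ^ 2 / θ }

lemma sinpos {θ : ℝ} (h0 : 0 < θ) (h1 : θ ≤ Real.pi / 2) : 0 < Real.sin θ :=
  Real.sin_pos_of_pos_of_lt_pi h0 (by linarith [Real.pi_pos])

lemma cosnn {θ : ℝ} (h0 : 0 < θ) (h1 : θ ≤ Real.pi / 2) : 0 ≤ Real.cos θ :=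
  Real.cos_nonneg_of_mem_Icc ⟨by linarith [Real.pi_pos], h1⟩

lemma ccball_sub (r : ℝ) : {Q : H | dH HO Q < r} ⊆ KK r := by
  intro p hp θ h0 h1
  obtain ⟨L, hL, hLr⟩ := exists_lt_of_dH hp
  rcases abs_choice p.2.2 with h | h
  · rw [h]
    simpa using calib (e := 1) hL hLr h0 h1 (by norm_num)
  · rw [h]
    simpa using calib (e := -1) hL hLr h0 h1 (by norm_num)

lemma KK_closed (r : ℝ) : IsClosed (KK r) := by
  have : KK r = ⋂ (θ : ℝ) (_ : 0 < θ) (_ : θ ≤ Real.pi / 2),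
      {p : H | |p.2.2| + (p.1 ^ 2 + p.2.1 ^ 2) * (Real.cos θ / Real.sin θ) ≤ r ^ 2 / θ} := by
    ext p; simp [KK]
  rw [this]
  refine isClosed_iInter fun θ => isClosed_iInter fun _ => isClosed_iInter fun _ => ?_
  exact isClosed_le (by fun_prop) (by fun_prop)

lemma KK_convex (r : ℝ) : Convex ℝ (KK r) := by
  intro p hp q hq a b ha hb hab θ h0 h1
  have hp := hp θ h0 h1
  have hq := hq θ h0 h1
  have hc : 0 ≤ Real.cos θ / Real.sin θ := div_nonneg (cosnn h0 h1) (sinpos h0 h1).le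
  obtain ⟨x, y, t⟩ := p
  obtain ⟨x', y', t'⟩ := q
  simp only [Prod.smul_mk, Prod.mk_add_mk, smul_eq_mul] at *
  have ht : |a * t + b * t'| ≤ a * |t| + b * |t'| := by
    refine (abs_add_le _ _).trans ?_
    rw [abs_mul, abs_mul, abs_of_nonneg ha, abs_of_nonneg hb]
  have hz : (a * x + b * x') ^ 2 + (a * y + b * y') ^ 2 ≤ a * (x ^ 2 + y ^ 2) + b * (x' ^ 2 + y' ^ 2) := by
    have hb' : b = 1 - a := by linarith
    have : a * (x ^ 2 + y ^ 2) + b * (x' ^ 2 + y' ^ 2) - ((a * x + b * x') ^ 2 + (a * y + b * y') ^ 2)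
      = a * b * ((x - x') ^ 2 + (y - y') ^ 2) := by
      subst hb'; ring
    have : 0 ≤ a * b * ((x - x') ^ 2 + (y - y') ^ 2) := by positivity
    linarith
  have hz' := mul_le_mul_of_nonneg_right hz hc
  have h3 := mul_le_mul_of_nonneg_left hp ha
  have h4 := mul_le_mul_of_nonneg_left hq hb
  have : a * (r ^ 2 / θ) + b * (r ^ 2 / θ) = r ^ 2 / θ := by rw [← add_mul, hab, one_mul]
  nlinarith

lemma KK_int {r : ℝ} {p : H} (h : 2 * |p.2.2| + (p.1 ^ 2 + p.2.1 ^ 2) < r ^ 2) :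
    p ∈ interior (KK r) := by
  have ho : IsOpen {p : H | 2 * |p.2.2| + (p.1 ^ 2 + p.2.1 ^ 2) < r ^ 2} :=
    isOpen_lt (by fun_prop) (by fun_prop)
  refine interior_maximal ?_ ho h
  intro q hq θ h0 h1
  have hq : 2 * |q.2.2| + (q.1 ^ 2 + q.2.1 ^ 2) < r ^ 2 := hq
  have hs := sinpos h0 h1
  have hcot : Real.cos θ / Real.sin θ ≤ 1 / θ := by
    rw [div_le_div_iff₀ hs h0]
    rcases h1.eq_or_lt with h | h
    · rw [h]; simp
    · have := Real.lt_tan h0 h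
      rw [Real.tan_eq_sin_div_cos, lt_div_iff₀ (Real.cos_pos_of_mem_Ioo ⟨by linarith, h⟩)] at this
      linarith
  have h2 := mul_le_mul_of_nonneg_left hcot (by positivity : 0 ≤ q.1 ^ 2 + q.2.1 ^ 2)
  have h3 : |q.2.2| + (q.1 ^ 2 + q.2.1 ^ 2) * (1 / θ) ≤ r ^ 2 / θ := by
    rw [le_div_iff₀ h0]
    have : (|q.2.2| + (q.1 ^ 2 + q.2.1 ^ 2) * (1 / θ)) * θ = |q.2.2| * θ + (q.1 ^ 2 + q.2.1 ^ 2) := by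
      field_simp
    rw [this]
    have : θ ≤ 2 := by linarith [Real.pi_le_four]
    nlinarith [abs_nonneg q.2.2]
  linarith

lemma KK_basic {r θ : ℝ} {p : H} (h : p ∈ KK r) (h0 : 0 < θ) (h1 : θ ≤ Real.pi / 2) :
    |p.2.2| * Real.sin θ + (p.1 ^ 2 + p.2.1 ^ 2) * Real.cos θ ≤ r ^ 2 := by
  have h2 := h θ h0 h1
  have hs := sinpos h0 h1
  have h3 := mul_le_mul_of_nonneg_right h2 hs.le
  have h4 : r ^ 2 / θ * Real.sin θ ≤ r ^ 2 := by
    rw [div_mul_eq_mul_div, div_le_iff₀ h0]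
    exact mul_le_mul_of_nonneg_left (Real.sin_le h0.le) (sq_nonneg r)
  have h5 : (|p.2.2| + (p.1 ^ 2 + p.2.1 ^ 2) * (Real.cos θ / Real.sin θ)) * Real.sin θ =
    |p.2.2| * Real.sin θ + (p.1 ^ 2 + p.2.1 ^ 2) * Real.cos θ := by field_simp
  linarith

lemma small_ev : ∀ᶠ θ in nhdsWithin (0:ℝ) (Set.Ioi 0), 0 < θ ∧ θ ≤ Real.pi / 2 := by
  filter_upwards [Ioc_mem_nhdsGT (half_pos Real.pi_pos)] with θ h using h

lemma KK_le {r : ℝ} {p : H} (h : p ∈ KK r) : p.1 ^ 2 + p.2.1 ^ 2 ≤ r ^ 2 := by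
  have hc : Filter.Tendsto (fun θ => |p.2.2| * Real.sin θ + (p.1 ^ 2 + p.2.1 ^ 2) * Real.cos θ)
      (nhdsWithin (0:ℝ) (Set.Ioi 0)) (nhds (|p.2.2| * Real.sin 0 + (p.1 ^ 2 + p.2.1 ^ 2) * Real.cos 0)) :=
    ((by fun_prop : Continuous fun θ =>
      |p.2.2| * Real.sin θ + (p.1 ^ 2 + p.2.1 ^ 2) * Real.cos θ).tendsto 0).mono_left nhdsWithin_le_nhds
  have := le_of_tendsto hc (small_ev.mono fun θ hθ => KK_basic h hθ.1 hθ.2)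
  simpa using this

lemma KK_eq {r : ℝ} {p : H} (h : p ∈ KK r) (he : p.1 ^ 2 + p.2.1 ^ 2 = r ^ 2) : p.2.2 = 0 := by
  have hc : Filter.Tendsto (fun θ => |p.2.2| * Real.cos (θ / 2) - r ^ 2 * Real.sin (θ / 2))
      (nhdsWithin (0:ℝ) (Set.Ioi 0)) (nhds (|p.2.2| * Real.cos (0 / 2) - r ^ 2 * Real.sin (0 / 2))) :=
    ((by fun_prop : Continuous fun θ =>
      |p.2.2| * Real.cos (θ / 2) - r ^ 2 * Real.sin (θ / 2)).tendsto 0).mono_left nhdsWithin_le_nhds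
  have := le_of_tendsto (b := 0) hc (small_ev.mono fun θ hθ => by
    have h1 := KK_basic h hθ.1 hθ.2
    have hs := sinpos (half_pos hθ.1) (by linarith [hθ.1, hθ.2])
    have e1 : Real.sin θ = 2 * Real.sin (θ / 2) * Real.cos (θ / 2) := by
      rw [← Real.sin_two_mul]; congr 1; ring
    have e2 : Real.cos θ = 1 - 2 * Real.sin (θ / 2) ^ 2 := by
      have := Real.cos_two_mul (θ / 2)
      rw [Real.cos_sq', show 2 * (θ / 2) = θ by ring] at this
      linarith
    rw [he, e1, e2] at h1
    have : Real.sin (θ / 2) * (|p.2.2| * Real.cos (θ / 2) - r ^ 2 * Real.sin (θ / 2)) ≤ 0 := by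
      linarith
    exact nonpos_of_mul_nonpos_right this hs)
  simp at this
  exact this

/-- Heisenberg dilations. -/
def dil (c : ℝ) (p : H) : H := (c * p.1, c * p.2.1, c ^ 2 * p.2.2)

lemma arc_dil {r θ c : ℝ} (hc : 0 ≤ c) {p : H} (h : arc r θ p) : arc (c * r) θ (dil c p) := by
  obtain ⟨h1, h2⟩ := h
  refine ⟨?_, ?_⟩
  · simp only [dil]
    rw [mul_assoc, ← h1, show (c * p.1) ^ 2 + (c * p.2.1) ^ 2 = c ^ 2 * (p.1 ^ 2 + p.2.1 ^ 2) by ring,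
      Real.sqrt_mul (sq_nonneg c), Real.sqrt_sq hc]
  · simp only [dil]
    rw [h2]; ring

lemma KK_dil {r c : ℝ} (hc : 0 < c) {p : H} : dil c p ∈ KK r ↔ p ∈ KK (r / c) := by
  have key : ∀ θ, (|(dil c p).2.2| + ((dil c p).1 ^ 2 + (dil c p).2.1 ^ 2) * (Real.cos θ / Real.sin θ) ≤ r ^ 2 / θ)
     ↔ (|p.2.2| + (p.1 ^ 2 + p.2.1 ^ 2) * (Real.cos θ / Real.sin θ) ≤ (r / c) ^ 2 / θ) := by
    intro θ
    have e1 : |(dil c p).2.2| + ((dil c p).1 ^ 2 + (dil c p).2.1 ^ 2) * (Real.cos θ / Real.sin θ) =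
      c ^ 2 * (|p.2.2| + (p.1 ^ 2 + p.2.1 ^ 2) * (Real.cos θ / Real.sin θ)) := by
      simp only [dil]
      rw [abs_mul, abs_of_nonneg (sq_nonneg c)]; ring
    have e2 : r ^ 2 / θ = c ^ 2 * ((r / c) ^ 2 / θ) := by field_simp
    rw [e1, e2]
    exact mul_le_mul_iff_right₀ (by positivity)
  simp only [KK, Set.mem_ofPred_eq, key]

lemma arc_mem_KK {r θ : ℝ} (hr : 0 < r) (hθ : |θ| ≤ Real.pi / 2) {p : H} (h : arc r θ p) :
    p ∈ KK r := by
  have hc : Filter.Tendsto (fun c : ℝ => dil c p) (nhdsWithin 1 (Set.Iio 1)) (nhds (dil 1 p)) :=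
    ((by unfold dil; fun_prop : Continuous fun c : ℝ => dil c p).tendsto 1).mono_left
      nhdsWithin_le_nhds
  have h1 : dil 1 p = p := by simp [dil]
  rw [h1] at hc
  refine (KK_closed r).mem_of_tendsto hc ?_
  filter_upwards [Ioo_mem_nhdsLT (show (0:ℝ) < 1 by norm_num)] with c hcm
  refine ccball_sub r ?_
  have := arc_dH (mul_pos hcm.1 hr) hθ (arc_dil hcm.1.le h)
  have h2 : c * r < r := by nlinarith [hcm.1, hcm.2]
  exact this.trans_lt h2

lemma int_dil {r : ℝ} {p : H} (h : p ∈ interior (KK r)) : ∃ c, 1 < c ∧ dil c p ∈ KK r := by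
  have hc : Filter.Tendsto (fun c : ℝ => dil c p) (nhdsWithin 1 (Set.Ioi 1)) (nhds (dil 1 p)) :=
    ((by unfold dil; fun_prop : Continuous fun c : ℝ => dil c p).tendsto 1).mono_left
      nhdsWithin_le_nhds
  have h1 : dil 1 p = p := by simp [dil]
  rw [h1] at hc
  have h2 := hc.eventually (isOpen_interior.mem_nhds h)
  have h3 := h2.and self_mem_nhdsWithin
  obtain ⟨c, hc1, hc2⟩ := h3.exists
  exact ⟨c, hc2, interior_subset hc1⟩

lemma conv_vert {s : Set H} (hs : Convex ℝ s) {x y t T : ℝ} (h1 : (x, y, T) ∈ s)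
    (h2 : (x, y, -T) ∈ s) (ht : |t| ≤ T) : (x, y, t) ∈ s := by
  obtain ⟨h3, h4⟩ := abs_le.1 ht
  rcases (abs_nonneg t |>.trans ht).eq_or_lt with h | h
  · have : t = T := by linarith
    rwa [this]
  · have := hs h1 h2 (a := (T + t) / (2 * T)) (b := (T - t) / (2 * T))
      (div_nonneg (by linarith) (by linarith)) (div_nonneg (by linarith) (by linarith))
      (by field_simp; ring)
    convert this using 1
    simp only [Prod.smul_mk, Prod.mk_add_mk, smul_eq_mul, Prod.mk.injEq]
    refine ⟨?_, ?_, ?_⟩ <;> field_simp <;> try ring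

lemma conv_hor {s : Set H} (hs : Convex ℝ s) {x y t T : ℝ} (h1 : (T, y, t) ∈ s)
    (h2 : (-T, y, t) ∈ s) (ht : |x| ≤ T) : (x, y, t) ∈ s := by
  obtain ⟨h3, h4⟩ := abs_le.1 ht
  rcases (abs_nonneg x |>.trans ht).eq_or_lt with h | h
  · have : x = T := by linarith
    rwa [this]
  · have := hs h1 h2 (a := (T + x) / (2 * T)) (b := (T - x) / (2 * T))
      (div_nonneg (by linarith) (by linarith)) (div_nonneg (by linarith) (by linarith))
      (by field_simp; ring)
    convert this using 1
    simp only [Prod.smul_mk, Prod.mk_add_mk, smul_eq_mul, Prod.mk.injEq]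
    refine ⟨?_, ?_, ?_⟩ <;> field_simp <;> try ring

lemma sinc_half : Real.sinc (Real.pi / 2) = 2 / Real.pi := by
  have := Real.pi_pos
  rw [Real.sinc_of_ne_zero (by positivity), Real.sin_pi_div_two]; field_simp

lemma arc_half {r : ℝ} {p : H} (h1 : Real.sqrt (p.1 ^ 2 + p.2.1 ^ 2) = 2 / Real.pi * r)
    (h2 : p.2.2 = 2 / Real.pi * r ^ 2) : arc r (Real.pi / 2) p := by
  have := Real.pi_pos
  refine ⟨by rw [h1, sinc_half]; ring, ?_⟩
  rw [h2]; simp; field_simp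

lemma arc_half' {r : ℝ} {p : H} (h1 : Real.sqrt (p.1 ^ 2 + p.2.1 ^ 2) = 2 / Real.pi * r)
    (h2 : p.2.2 = -(2 / Real.pi * r ^ 2)) : arc r (-(Real.pi / 2)) p := by
  have := Real.pi_pos
  refine ⟨by rw [h1, Real.sinc_neg, sinc_half]; ring, ?_⟩
  rw [h2]; simp; field_simp

lemma disc_mem {r : ℝ} (hr : 0 < r) {s : Set H} (hs : Convex ℝ s)
    (hE : ∀ θ, |θ| ≤ Real.pi / 2 → ∀ p, arc r θ p → p ∈ s) {x y t : ℝ}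
    (h : Real.sqrt (x ^ 2 + y ^ 2) ≤ 2 / Real.pi * r)
    (ht : t = 2 / Real.pi * r ^ 2 ∨ t = -(2 / Real.pi * r ^ 2)) : (x, y, t) ∈ s := by
  have hpi := Real.pi_pos
  have hR : 0 ≤ 2 / Real.pi * r := by positivity
  obtain ⟨R, hRe⟩ : ∃ R, R = 2 / Real.pi * r := ⟨_, rfl⟩
  rw [← hRe] at h hR
  have h2 : x ^ 2 + y ^ 2 ≤ R ^ 2 := by
    rw [← Real.sqrt_le_sqrt_iff (by positivity), Real.sqrt_sq hR]; exact h
  have key : ∀ w : ℝ, w ^ 2 = R ^ 2 - y ^ 2 → (w, y, t) ∈ s := by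
    intro w hw
    have e : Real.sqrt (w ^ 2 + y ^ 2) = 2 / Real.pi * r := by
      rw [← hRe, hw, sub_add_cancel, Real.sqrt_sq hR]
    rcases ht with ht | ht
    · exact hE (Real.pi / 2) (by rw [abs_of_pos (by positivity)]) _ (arc_half e ht)
    · exact hE (-(Real.pi / 2)) (by rw [abs_neg, abs_of_pos (by positivity)]) _ (arc_half' e ht)
  have hn : 0 ≤ R ^ 2 - y ^ 2 := by nlinarith [sq_nonneg x]
  refine conv_hor hs (T := Real.sqrt (R ^ 2 - y ^ 2)) (key _ (Real.sq_sqrt hn))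
    (key _ (by rw [neg_sq, Real.sq_sqrt hn])) ?_
  exact Real.abs_le_sqrt (by linarith)

lemma cases_R {r R : ℝ} (hr : 0 < r) (h : R ≤ r) :
    R ≤ 2 / Real.pi * r ∨ ∃ θ, 0 ≤ θ ∧ θ ≤ Real.pi / 2 ∧ R = r * Real.sinc θ := by
  rcases le_total R (2 / Real.pi * r) with h1 | h1
  · exact Or.inl h1
  · right
    have := intermediate_value_Icc' (f := fun θ => r * Real.sinc θ) (a := 0) (b := Real.pi / 2)
      (by linarith [Real.pi_pos]) (by fun_prop)
    obtain ⟨θ, hθ, h3⟩ := this (show R ∈ _ from ⟨by rw [sinc_half]; linarith, by simpa using h⟩)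
    exact ⟨θ, hθ.1, hθ.2, h3.symm⟩

/-- Over each admissible `z` there is a top height `T`. -/
lemma top {r x y : ℝ} (hr : 0 < r) (hz : x ^ 2 + y ^ 2 ≤ r ^ 2) :
    ∃ T : ℝ, 0 ≤ T ∧ (∀ t, (x, y, t) ∈ KK r → |t| ≤ T) ∧
    (((∃ θ, |θ| ≤ Real.pi / 2 ∧ arc r θ (x, y, T)) ∧ (∃ θ, |θ| ≤ Real.pi / 2 ∧ arc r θ (x, y, -T))) ∨
     (T = 2 / Real.pi * r ^ 2 ∧ Real.sqrt (x ^ 2 + y ^ 2) ≤ 2 / Real.pi * r)) := by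
  have hpi := Real.pi_pos
  have hR : Real.sqrt (x ^ 2 + y ^ 2) ≤ r := Real.sqrt_le_iff.2 ⟨hr.le, hz⟩
  rcases cases_R hr hR with h | ⟨θ, h0, h1, h2⟩
  · refine ⟨2 / Real.pi * r ^ 2, by positivity, ?_, Or.inr ⟨rfl, h⟩⟩
    intro t ht
    have := ht (Real.pi / 2) (by positivity) le_rfl
    simp at this
    calc |t| ≤ _ := this
      _ = _ := by field_simp
  · rcases h0.eq_or_lt with h0 | h0
    · subst h0
      simp at h2
      refine ⟨0, le_rfl, ?_, Or.inl ⟨⟨0, by simp; positivity, ?_⟩, ⟨0, by simp; positivity, ?_⟩⟩⟩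
      · intro t ht
        have := KK_eq ht (by rw [← h2, Real.sq_sqrt (by positivity)])
        simp at this
        simp [this]
      · exact ⟨by simp [h2], by simp⟩
      · exact ⟨by simp [h2], by simp⟩
    · have hs := sinpos h0 h1
      have hq : x ^ 2 + y ^ 2 = (r * (Real.sin θ / θ)) ^ 2 := by
        rw [← Real.sinc_of_ne_zero h0.ne', ← h2, Real.sq_sqrt (by positivity)]
      refine ⟨r ^ 2 * ((θ - Real.sin θ * Real.cos θ) / θ ^ 2), ?_, ?_, Or.inl
        ⟨⟨θ, by rwa [abs_of_pos h0], h2, rfl⟩, ⟨-θ, by rwa [abs_neg, abs_of_pos h0], ?_, ?_⟩⟩⟩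
      · have : Real.sin θ * Real.cos θ ≤ θ := by
          have := Real.sin_le h0.le
          have := Real.cos_le_one θ
          nlinarith
        have : 0 ≤ θ - Real.sin θ * Real.cos θ := by linarith
        positivity
      · intro t ht
        have := ht θ h0 h1
        simp only at this
        rw [hq] at this
        have e : r ^ 2 * ((θ - Real.sin θ * Real.cos θ) / θ ^ 2) =
          r ^ 2 / θ - (r * (Real.sin θ / θ)) ^ 2 * (Real.cos θ / Real.sin θ) := by field_simp
        rw [e]; linarith
      · simpa using h2
      · simp; ring

lemma KK_sub {r : ℝ} (hr : 0 < r) {s : Set H} (hs : Convex ℝ s)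
    (hE : ∀ θ, |θ| ≤ Real.pi / 2 → ∀ p, arc r θ p → p ∈ s) : KK r ⊆ s := by
  rintro ⟨x, y, t⟩ hp
  obtain ⟨T, hT, hle, h⟩ := top hr (KK_le hp)
  have ht := hle t hp
  rcases h with ⟨⟨θ, h1, h2⟩, ⟨θ', h1', h2'⟩⟩ | ⟨h1, h2⟩
  · exact conv_vert hs (hE _ h1 _ h2) (hE _ h1' _ h2') ht
  · exact conv_vert hs (disc_mem hr hs hE h2 (Or.inl h1))
      (disc_mem hr hs hE h2 (Or.inr (by rw [h1]))) ht

lemma int_sub {r : ℝ} (hr : 0 < r) : interior (KK r) ⊆ convexHull ℝ {Q : H | dH HO Q < r} := by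
  intro p hp
  obtain ⟨c, hc, h⟩ := int_dil hp
  have hc0 : 0 < c := by linarith
  rw [KK_dil hc0] at h
  refine KK_sub (div_pos hr hc0) (convex_convexHull ℝ _) (fun θ hθ q hq => ?_) h
  refine subset_convexHull ℝ _ ?_
  exact (arc_dH (div_pos hr hc0) hθ hq).trans_lt (div_lt_self hr hc)

lemma frontier_eq {r : ℝ} (hr : 0 < r) :
    frontier (convexHull ℝ {Q : H | dH HO Q < r}) = KK r \ interior (KK r) := by
  have h1 := int_sub hr
  have h2 : convexHull ℝ {Q : H | dH HO Q < r} ⊆ KK r := convexHull_min (ccball_sub r) (KK_convex r)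
  have hi : interior (convexHull ℝ {Q : H | dH HO Q < r}) = interior (KK r) :=
    (interior_mono h2).antisymm (interior_maximal h1 isOpen_interior)
  have hne : (interior (KK r)).Nonempty := ⟨(0, 0, 0), KK_int (by simp; positivity)⟩
  have hcl : closure (convexHull ℝ {Q : H | dH HO Q < r}) = KK r := by
    refine (closure_minimal h2 (KK_closed r)).antisymm ?_
    have := (KK_convex r).closure_interior_eq_closure_of_nonempty_interior hne
    rw [(KK_closed r).closure_eq] at this
    calc KK r = _ := this.symm
      _ ⊆ _ := closure_mono h1
  rw [frontier, hi, hcl]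

lemma not_int_of_eq {r θ : ℝ} (hr : 0 < r) {p : H} (h0 : 0 < θ) (h1 : θ ≤ Real.pi / 2)
    (h : |p.2.2| + (p.1 ^ 2 + p.2.1 ^ 2) * (Real.cos θ / Real.sin θ) = r ^ 2 / θ) :
    p ∉ interior (KK r) := by
  intro hp
  obtain ⟨c, hc, h2⟩ := int_dil hp
  have hc0 : 0 < c := by linarith
  rw [KK_dil hc0] at h2
  have h3 := h2 θ h0 h1
  rw [h, div_le_div_iff_of_pos_right h0] at h3
  have := div_lt_self hr hc
  have : 0 < r / c := by positivity
  nlinarith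

lemma arc_not_int {r θ : ℝ} (hr : 0 < r) (hθ : |θ| ≤ Real.pi / 2) {p : H} (h : arc r θ p) :
    p ∉ interior (KK r) := by
  obtain ⟨h1, h2⟩ := h
  by_cases h0 : θ = 0
  · subst h0
    simp at h1
    intro hp
    obtain ⟨c, hc, h3⟩ := int_dil hp
    have hc0 : 0 < c := by linarith
    rw [KK_dil hc0] at h3
    have h4 := KK_le h3
    have h5 : p.1 ^ 2 + p.2.1 ^ 2 = r ^ 2 := by rw [← h1, Real.sq_sqrt (by positivity)]
    have := div_lt_self hr hc
    have : 0 < r / c := by positivity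
    nlinarith
  · have ha : 0 < |θ| := abs_pos.2 h0
    have hs := sinpos ha hθ
    refine not_int_of_eq hr ha hθ ?_
    have hq : p.1 ^ 2 + p.2.1 ^ 2 = (r * (Real.sin |θ| / |θ|)) ^ 2 := by
      have : Real.sinc θ = Real.sin |θ| / |θ| := by
        rw [← Real.sinc_of_ne_zero ha.ne']
        rcases abs_choice θ with h | h <;> rw [h]
        rw [Real.sinc_neg]
      rw [← this, ← h1, Real.sq_sqrt (by positivity)]
    have ht : |p.2.2| = r ^ 2 * ((|θ| - Real.sin |θ| * Real.cos |θ|) / |θ| ^ 2) := by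
      have hnn : 0 ≤ |θ| - Real.sin |θ| * Real.cos |θ| := by
        have := Real.sin_le ha.le
        have := Real.cos_le_one |θ|
        nlinarith
      have hnn' : 0 ≤ r ^ 2 * ((|θ| - Real.sin |θ| * Real.cos |θ|) / |θ| ^ 2) := by positivity
      rw [h2]
      rcases abs_choice θ with h | h
      · rw [h] at hnn' ⊢
        exact abs_of_nonneg hnn'
      · rw [← abs_of_nonneg hnn', h, ← abs_neg]
        congr 1
        simp; ring
    rw [hq, ht]
    generalize |θ| = u at *
    field_simp
    ring

lemma bdry_iff {r : ℝ} (hr : 0 < r) (p : H) : p ∈ KK r \ interior (KK r) ↔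
    (∃ θ, |θ| ≤ Real.pi / 2 ∧ arc r θ p) ∨
    ((p.2.2 = 2 / Real.pi * r ^ 2 ∨ p.2.2 = -(2 / Real.pi * r ^ 2)) ∧
      Real.sqrt (p.1 ^ 2 + p.2.1 ^ 2) ≤ 2 / Real.pi * r) := by
  have hpi := Real.pi_pos
  have hE : ∀ θ, |θ| ≤ Real.pi / 2 → ∀ p, arc r θ p → p ∈ KK r := fun θ hθ p h => arc_mem_KK hr hθ h
  obtain ⟨x, y, t⟩ := p
  constructor
  · rintro ⟨hp, hni⟩
    obtain ⟨T, hT, hle, h⟩ := top hr (KK_le hp)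
    have hmem : (x, y, T) ∈ KK r ∧ (x, y, -T) ∈ KK r := by
      rcases h with ⟨⟨θ, h1, h2⟩, ⟨θ', h1', h2'⟩⟩ | ⟨h1, h2⟩
      · exact ⟨hE _ h1 _ h2, hE _ h1' _ h2'⟩
      · exact ⟨disc_mem hr (KK_convex r) hE h2 (Or.inl h1),
          disc_mem hr (KK_convex r) hE h2 (Or.inr (by rw [h1]))⟩
    have ht := hle t hp
    have hTt : |t| = T := by
      by_contra hne
      have hlt := lt_of_le_of_ne ht hne
      have hTp : 0 < T := (abs_nonneg t).trans_lt hlt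
      have hzr : x ^ 2 + y ^ 2 < r ^ 2 := by
        refine lt_of_le_of_ne (KK_le hp) fun he => ?_
        have := KK_eq hmem.1 he
        simp only at this
        linarith
      have hmid : (x, y, (0:ℝ)) ∈ interior (KK r) := KK_int (by simpa using hzr)
      apply hni
      have key : ∀ ε : ℝ, ε * |t| = t → (x, y, ε * T) ∈ KK r → (x, y, t) ∈ interior (KK r) := by
        intro ε hε hm
        have := (KK_convex r).combo_interior_self_mem_interior hmid hm (a := 1 - |t| / T) (b := |t| / T)
          (by rw [sub_pos, div_lt_one hTp]; exact hlt) (by positivity) (by ring)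
        convert this using 1
        simp only [Prod.smul_mk, Prod.mk_add_mk, smul_eq_mul, Prod.mk.injEq]
        refine ⟨by ring, by ring, ?_⟩
        field_simp
        linear_combination (-T) * hε
      rcases abs_choice t with h | h
      · exact key 1 (by linarith) (by simpa using hmem.1)
      · exact key (-1) (by linarith) (by simpa using hmem.2)
    have hc : t = T ∨ t = -T := by
      rcases abs_choice t with h | h
      · left; linarith
      · right; linarith
    rcases h with ⟨h1, h2⟩ | ⟨h1, h2⟩
    · left
      rcases hc with rfl | rfl
      · exact h1
      · exact h2
    · right
      exact ⟨by rcases hc with h | h <;> simp [h, h1], h2⟩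
  · rintro (⟨θ, h1, h2⟩ | ⟨h1, h2⟩)
    · exact ⟨hE _ h1 _ h2, arc_not_int hr h1 h2⟩
    · refine ⟨disc_mem hr (KK_convex r) hE h2 h1, ?_⟩
      refine not_int_of_eq hr (half_pos hpi) le_rfl ?_
      have : |t| = 2 / Real.pi * r ^ 2 := by
        have : 0 ≤ 2 / Real.pi * r ^ 2 := by positivity
        rcases h1 with h | h <;> simp only at h <;> rw [h]
        · exact abs_of_nonneg this
        · rw [abs_neg, abs_of_nonneg this]
      simp [this]
      field_simp

lemma arc_iff {r φ : ℝ} (hr : 0 < r) (p : H) :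
    ((φ = 0 ∧ Real.sqrt (p.1 ^ 2 + p.2.1 ^ 2) = r ∧ p.2.2 = 0) ∨
             (φ ≠ 0 ∧
              Real.sqrt (p.1 ^ 2 + p.2.1 ^ 2) = 2 * Real.sin (φ * r / 2) / φ ∧
              p.2.2 = 2 * (φ * r - Real.sin (φ * r)) / φ ^ 2)) ↔ arc r (φ * r / 2) p := by
  by_cases h : φ = 0
  · subst h
    simp [arc]
  · have h' : φ * r / 2 ≠ 0 := by positivity
    have e1 : r * (Real.sin (φ * r / 2) / (φ * r / 2)) = 2 * Real.sin (φ * r / 2) / φ := by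
      field_simp
    have e2 : r ^ 2 * ((φ * r / 2 - Real.sin (φ * r / 2) * Real.cos (φ * r / 2)) / (φ * r / 2) ^ 2)
      = 2 * (φ * r - Real.sin (φ * r)) / φ ^ 2 := by
      have : Real.sin (φ * r) = 2 * Real.sin (φ * r / 2) * Real.cos (φ * r / 2) := by
        rw [← Real.sin_two_mul]; congr 1; ring
      rw [this]
      field_simp
    simp only [arc, Real.sinc_of_ne_zero h', e1, e2, h, false_and, false_or, ne_eq, not_false_eq_true,
      true_and]

/-- Euclidean convex hull of a Carnot ball.
For every `r > 0`, the boundary of the Euclidean convex hull of `B(O,r)` is the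
union of the set of points of `S(O,r)` with parameter `|φ|r ≤ π` (in the
standard parametrization `|z| = 2 sin(φr/2)/φ`, `t = 2(φr − sin(φr))/φ²`, with
`|z| = r`, `t = 0` for `φ = 0`) and the two discs
`{(z;t) : t = ±(2/π)r², |z| ≤ (2/π)r}`. -/
theorem statement9 :
    ∀ r : ℝ, 0 < r →
      frontier (convexHull ℝ {Q : H | dH HO Q < r}) =
        { p : H | ∃ φ : ℝ, |φ| * r ≤ Real.pi ∧
            ((φ = 0 ∧ Real.sqrt (p.1 ^ 2 + p.2.1 ^ 2) = r ∧ p.2.2 = 0) ∨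
             (φ ≠ 0 ∧
              Real.sqrt (p.1 ^ 2 + p.2.1 ^ 2) = 2 * Real.sin (φ * r / 2) / φ ∧
              p.2.2 = 2 * (φ * r - Real.sin (φ * r)) / φ ^ 2)) } ∪
        { p : H | p.2.2 = 2 / Real.pi * r ^ 2 ∧
            Real.sqrt (p.1 ^ 2 + p.2.1 ^ 2) ≤ 2 / Real.pi * r } ∪
        { p : H | p.2.2 = -(2 / Real.pi * r ^ 2) ∧
            Real.sqrt (p.1 ^ 2 + p.2.1 ^ 2) ≤ 2 / Real.pi * r } := by
  intro r hr
  rw [frontier_eq hr]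
  ext p
  rw [bdry_iff hr]
  simp only [Set.mem_union, Set.mem_ofPred_eq, arc_iff hr]
  have : (∃ θ, |θ| ≤ Real.pi / 2 ∧ arc r θ p) ↔ ∃ φ : ℝ, |φ| * r ≤ Real.pi ∧ arc r (φ * r / 2) p := by
    constructor
    · rintro ⟨θ, h1, h2⟩
      refine ⟨2 * θ / r, ?_, ?_⟩
      · rw [abs_div, abs_mul, abs_of_pos hr, div_mul_cancel₀ _ hr.ne', abs_two]; linarith
      · convert h2 using 1; field_simp
    · rintro ⟨φ, h1, h2⟩
      refine ⟨_, ?_, h2⟩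
      rw [abs_div, abs_mul, abs_of_pos hr, abs_two]; linarith
  rw [this, or_and_right, or_assoc]
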